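/- There exists a constant C > 0 such that for all integers a, b ≥ 1 and every integer k with 0 ≤ k ≤ ab, the number of permutations w of {1, …, a+b} with xinv(w) = k is at most C · (a+b)! / √(a·b·(a+b)). -/

import Mathlib

/-- Number of pairs of disjoint sets `(J, D)` in `range h`, `|J| = m`, `m + 2|D| = c`. -/
def xq (h c m : ℕ) : ℕ :=
  h.choose m * (if m ≤ c then (if 2 ∣ c - m then (h - m).choose ((c - m) / 2) else 0) else 0)

lemma xq_sum (h c : ℕ) : ∑ m ∈ Finset.range (h + 1), xq h c m * 2 ^ m = (2 * h).choose c := by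
  have key : ((1 + Polynomial.X : Polynomial ℕ)) ^ (2 * h)
      = ∑ m ∈ Finset.range (h + 1), Polynomial.X ^ m *
          (Polynomial.expand ℕ 2 ((1 + Polynomial.X) ^ (h - m))) *
            (((2 ^ m * h.choose m : ℕ)) : Polynomial ℕ) := by
    have : ((1 + Polynomial.X : Polynomial ℕ)) ^ 2
        = 2 * Polynomial.X + (1 + Polynomial.X ^ 2) := by ring
    rw [pow_mul, this, add_pow]
    refine Finset.sum_congr rfl fun m _ => ?_
    simp only [map_pow, map_add, map_one, Polynomial.expand_X]
    push_cast
    ring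
  have h2 := congrArg (fun p => Polynomial.coeff p c) key
  simp only [Polynomial.coeff_one_add_X_pow, Polynomial.finsetSum_coeff,
    Polynomial.coeff_mul_natCast, Polynomial.coeff_X_pow_mul',
    Polynomial.coeff_expand (show 0 < 2 by norm_num)] at h2
  simp only [Nat.cast_id] at h2
  rw [h2]
  refine Finset.sum_congr rfl fun m _ => ?_
  unfold xq
  ring

lemma xq_shift (h c m : ℕ) : xq h c m * (h + 1) = (m + 1) * xq (h + 1) (c + 1) (m + 1) := by
  unfold xq
  have := Nat.add_one_mul_choose_eq h m
  simp only [Nat.add_sub_add_right, Nat.add_le_add_iff_right]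
  rw [mul_right_comm, mul_comm (h.choose m), this]
  ring

lemma cb_sq (k : ℕ) : (2 * k + 1) * k.centralBinom ^ 2 ≤ 16 ^ k := by
  induction k with
  | zero => simp
  | succ k ih =>
    have h := Nat.succ_mul_centralBinom_succ k
    have h1 : (k + 1) ^ 2 * ((2 * (k + 1) + 1) * (k + 1).centralBinom ^ 2)
        ≤ (k + 1) ^ 2 * 16 ^ (k + 1) := by
      calc (k + 1) ^ 2 * ((2 * (k + 1) + 1) * (k + 1).centralBinom ^ 2)
          = (2 * (k + 1) + 1) * ((k + 1) * (k + 1).centralBinom) ^ 2 := by ring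
        _ = (4 * (2 * k + 3) * (2 * k + 1)) * ((2 * k + 1) * k.centralBinom ^ 2) := by
            rw [h]; ring
        _ ≤ (16 * (k + 1) ^ 2) * 16 ^ k := by
            apply Nat.mul_le_mul _ ih
            nlinarith
        _ = _ := by ring
    exact Nat.le_of_mul_le_mul_left h1 (by positivity)

lemma mid_sq (m : ℕ) : (m + 1) * (m.choose (m / 2)) ^ 2 ≤ 4 ^ m := by
  rcases Nat.even_or_odd' m with ⟨k, rfl | rfl⟩
  · have := cb_sq k
    rw [Nat.centralBinom_eq_two_mul_choose] at this
    rw [Nat.mul_div_cancel_left _ (by norm_num), pow_mul]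
    norm_num
    exact this
  · have h := cb_sq (k + 1)
    have e : (k + 1).centralBinom = 2 * (2 * k + 1).choose k := by
      rw [Nat.centralBinom_eq_two_mul_choose, show 2 * (k + 1) = (2 * k + 1) + 1 by ring,
        Nat.choose_succ_succ, Nat.choose_symm_half]
      ring
    rw [e] at h
    have e2 : (2 * k + 1) / 2 = k := by omega
    rw [e2, pow_add, pow_mul]
    norm_num
    rw [pow_succ 16] at h
    nlinarith

lemma sum_bound (h c : ℕ) (hc : c ≤ h) :
    (c + 1) * (∑ m ∈ Finset.range (h + 1), xq h c m * m.choose (m / 2)) ^ 2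
      ≤ 2 * ((2 * h).choose c) ^ 2 := by
  have cs := Finset.sum_sq_le_sum_mul_sum_of_sq_le_mul (R := ℝ) (Finset.range (h + 1))
    (r := fun m => (xq h c m : ℝ) * m.choose (m / 2))
    (f := fun m => (xq h c m : ℝ) * 2 ^ m)
    (g := fun m => (xq h c m : ℝ) * 2 ^ m / (m + 1))
    (fun _ _ => by positivity) (fun _ _ => by positivity) (by
      intro m _
      have h1 : ((m : ℝ) + 1) * (m.choose (m / 2)) ^ 2 ≤ 4 ^ m := by exact_mod_cast mid_sq m
      have h2 : ((m.choose (m / 2) : ℝ)) ^ 2 ≤ 4 ^ m / (m + 1) := by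
        rw [le_div_iff₀ (by positivity)]; linarith
      have h4 : (4 : ℝ) ^ m = 2 ^ m * 2 ^ m := by rw [← mul_pow]; norm_num
      calc ((xq h c m : ℝ) * m.choose (m / 2)) ^ 2
          = (xq h c m : ℝ) ^ 2 * (m.choose (m / 2)) ^ 2 := by ring
        _ ≤ (xq h c m : ℝ) ^ 2 * (4 ^ m / (m + 1)) := by gcongr
        _ = _ := by rw [h4]; ring)
  have s1 : ∑ m ∈ Finset.range (h + 1), (xq h c m : ℝ) * 2 ^ m = (2 * h).choose c := by
    exact_mod_cast xq_sum h c
  have s2 : (∑ m ∈ Finset.range (h + 1), (xq h c m : ℝ) * 2 ^ m / (m + 1)) * (2 * (h + 1))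
      ≤ (2 * (h + 1)).choose (c + 1) := by
    have : ((2 * (h + 1)).choose (c + 1) : ℝ)
        = ∑ m ∈ Finset.range (h + 1 + 1), (xq (h + 1) (c + 1) m : ℝ) * 2 ^ m := by
      exact_mod_cast (xq_sum (h + 1) (c + 1)).symm
    rw [this, Finset.sum_range_succ' _ (h + 1), Finset.sum_mul]
    have : ∀ m ∈ Finset.range (h + 1), (xq h c m : ℝ) * 2 ^ m / (m + 1) * (2 * (h + 1))
        = (xq (h + 1) (c + 1) (m + 1) : ℝ) * 2 ^ (m + 1) := by
      intro m _
      have := xq_shift h c m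
      have : (xq h c m : ℝ) * (h + 1) = (m + 1) * xq (h + 1) (c + 1) (m + 1) := by
        exact_mod_cast this
      have hm : (m : ℝ) + 1 ≠ 0 := by positivity
      field_simp
      rw [pow_succ]
      linear_combination 2 ^ m * 2 * this
    rw [Finset.sum_congr rfl this]
    have : (0 : ℝ) ≤ (xq (h + 1) (c + 1) 0 : ℝ) * 2 ^ 0 := by positivity
    linarith
  -- binomial estimates
  have b1 : (2 * (h : ℝ) + 2) * (2 * h + 1).choose c = (2 * (h + 1)).choose (c + 1) * (c + 1) := by
    exact_mod_cast Nat.add_one_mul_choose_eq (2 * h + 1) c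
  have b2 : ((2 * h).choose c : ℝ) * (2 * h + 1) = (2 * h + 1).choose c * (2 * h + 1 - c) := by
    have := Nat.choose_mul_succ_eq (2 * h) c
    have h3 : ((2 * h + 1 - c : ℕ) : ℝ) = 2 * h + 1 - c := by
      rw [Nat.cast_sub (by omega)]; push_cast; ring
    rw [← h3]
    exact_mod_cast this
  rw [s1] at cs
  set S := ∑ m ∈ Finset.range (h + 1), (xq h c m : ℝ) * 2 ^ m / (m + 1)
  have hcR : (c : ℝ) ≤ h := by exact_mod_cast hc
  have b3 : ((2 * h + 1).choose c : ℝ) ≤ 2 * (2 * h).choose c := by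
    have h0 : (0 : ℝ) ≤ (2 * h + 1).choose c := by positivity
    have : ((2 * h + 1).choose c : ℝ) * (2 * h + 1) ≤ 2 * (2 * h).choose c * (2 * h + 1) := by
      nlinarith
    exact le_of_mul_le_mul_right this (by positivity)
  have s3 : S * (c + 1) ≤ 2 * (2 * h).choose c := by
    have : S * (c + 1) * (2 * (h + 1)) ≤ 2 * (2 * h).choose c * (2 * (h + 1)) := by
      have := mul_le_mul_of_nonneg_right s2 (show (0 : ℝ) ≤ c + 1 by positivity)
      nlinarith
    exact le_of_mul_le_mul_right this (by positivity)
  have fin : ((c : ℝ) + 1) * (∑ m ∈ Finset.range (h + 1), (xq h c m : ℝ) * m.choose (m / 2)) ^ 2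
      ≤ 2 * ((2 * h).choose c : ℝ) ^ 2 := by
    have h1 := mul_le_mul_of_nonneg_left cs (show (0 : ℝ) ≤ c + 1 by positivity)
    have h2 := mul_le_mul_of_nonneg_left s3 (show (0 : ℝ) ≤ (2 * h).choose c by positivity)
    nlinarith
  exact_mod_cast fin

lemma window (h c K : ℕ) (hh : 0 < h) :
    (((Finset.range (2 * h)).powersetCard c).filter
      (fun B => ∑ x ∈ B, x ≤ K ∧ K < ∑ x ∈ B, x + 2 * h)).card
      ≤ ∑ m ∈ Finset.range (h + 1), xq h c m * (2 * m.choose (m / 2)) := by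
  classical
  let t : Finset ℕ → Finset ℕ → ℕ := fun J D =>
    (K - (∑ x ∈ J, x + 2 * ∑ x ∈ D, x + h * D.card)) / h
  let DD : Finset ℕ → Finset (Finset ℕ) := fun J =>
    if J.card ≤ c then (if 2 ∣ c - J.card then
      (Finset.range h \ J).powersetCard ((c - J.card) / 2) else ∅) else ∅
  let T : Finset ((_ : Finset ℕ) × (_ : Finset ℕ) × Finset ℕ) :=
    (Finset.range h).powerset.sigma fun J => (DD J).sigma fun D =>
      J.powersetCard (t J D) ∪ J.powersetCard (t J D - 1)
  let f : ((_ : Finset ℕ) × (_ : Finset ℕ) × Finset ℕ) → Finset ℕ := fun z =>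
    (z.2.1 ∪ (z.1 \ z.2.2)) ∪ (z.2.1 ∪ z.2.2).image (· + h)
  have hT : T.card ≤ ∑ m ∈ Finset.range (h + 1), xq h c m * (2 * m.choose (m / 2)) := by
    have h1 : T.card ≤ ∑ J ∈ (Finset.range h).powerset,
        (if J.card ≤ c then (if 2 ∣ c - J.card then
          (h - J.card).choose ((c - J.card) / 2) else 0) else 0)
          * (2 * J.card.choose (J.card / 2)) := by
      rw [Finset.card_sigma]
      refine Finset.sum_le_sum fun J hJ => ?_
      have hDD : (DD J).card = (if J.card ≤ c then (if 2 ∣ c - J.card then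
          (h - J.card).choose ((c - J.card) / 2) else 0) else 0) := by
        have : (Finset.range h \ J).card = h - J.card := by
          rw [Finset.card_sdiff_of_subset (Finset.mem_powerset.1 hJ), Finset.card_range]
        simp only [DD]
        split_ifs <;> simp [this]
      rw [Finset.card_sigma, ← hDD, ← smul_eq_mul, ← Finset.sum_const]
      refine Finset.sum_le_sum fun D _ => ?_
      refine (Finset.card_union_le _ _).trans ?_
      rw [Finset.card_powersetCard, Finset.card_powersetCard]
      have e1 := Nat.choose_le_middle (t J D) J.card
      have e2 := Nat.choose_le_middle (t J D - 1) J.card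
      omega
    refine h1.trans (le_of_eq ?_)
    rw [Finset.sum_powerset_apply_card (fun m => (if m ≤ c then (if 2 ∣ c - m then
          (h - m).choose ((c - m) / 2) else 0) else 0) * (2 * m.choose (m / 2))),
      Finset.card_range]
    refine Finset.sum_congr rfl fun m _ => ?_
    unfold xq
    rw [smul_eq_mul, mul_assoc]
  refine le_trans (le_trans (Finset.card_le_card ?_) (Finset.card_image_le (s := T) (f := f))) hT
  intro B hB
  rw [Finset.mem_filter, Finset.mem_powersetCard] at hB
  obtain ⟨⟨hBs, hBc⟩, hB1, hB2⟩ := hB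
  set P := B.filter (· < h) with hP
  set Q := (Finset.range h).filter (fun i => i + h ∈ B) with hQ
  have hBPQ : B = P ∪ Q.image (· + h) := by
    ext x
    simp only [hP, hQ, Finset.mem_union, Finset.mem_filter, Finset.mem_image, Finset.mem_range]
    constructor
    · intro hx
      by_cases hxh : x < h
      · exact Or.inl ⟨hx, hxh⟩
      · have := Finset.mem_range.1 (hBs hx)
        refine Or.inr ⟨x - h, ⟨by omega, ?_⟩, by omega⟩
        rwa [Nat.sub_add_cancel (by omega)]
    · rintro (⟨hx, _⟩ | ⟨y, ⟨_, hy⟩, rfl⟩)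
      · exact hx
      · exact hy
  have hdisj : Disjoint P (Q.image (· + h)) := by
    rw [Finset.disjoint_left]
    intro x hx hx2
    simp only [hP, Finset.mem_filter, Finset.mem_image] at hx hx2
    obtain ⟨y, _, rfl⟩ := hx2
    omega
  have hinj : Function.Injective (fun x : ℕ => x + h) := fun x y hxy => by simpa using hxy
  have hcard : B.card = P.card + Q.card := by
    conv_lhs => rw [hBPQ]
    rw [Finset.card_union_of_disjoint hdisj, Finset.card_image_of_injective _ hinj]
  have hsum : ∑ x ∈ B, x = ∑ x ∈ P, x + (∑ x ∈ Q, x + h * Q.card) := by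
    conv_lhs => rw [hBPQ]
    rw [Finset.sum_union hdisj, Finset.sum_image (fun x _ y _ hxy => hinj hxy),
      Finset.sum_add_distrib, Finset.sum_const, smul_eq_mul, mul_comm h]
  have hPr : P ⊆ Finset.range h := fun x hx => by
    simp only [hP, Finset.mem_filter] at hx; simpa using hx.2
  have hQr : Q ⊆ Finset.range h := Finset.filter_subset _ _
  clear_value P Q
  set D := P ∩ Q with hD
  set J := (P ∪ Q) \ D with hJ
  set R := Q \ P with hR
  have hDU : D ⊆ P ∪ Q := Finset.inter_subset_left.trans Finset.subset_union_left
  have s1 := Finset.sum_union_inter (s₁ := P) (s₂ := Q) (f := fun x => x)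
  have s2 := Finset.sum_sdiff (f := fun x => x) hDU
  have c1 := Finset.card_union_add_card_inter P Q
  have c2 := Finset.card_sdiff_add_card_eq_card hDU
  have c3 : R.card + D.card = Q.card := by
    rw [hR, hD, Finset.inter_comm]; exact Finset.card_sdiff_add_card_inter Q P
  rw [← hD] at s1 c1
  rw [← hJ] at s2 c2
  rw [Finset.mem_image]
  refine ⟨⟨J, D, R⟩, ?_, ?_⟩
  · simp only [T, Finset.mem_sigma, Finset.mem_powerset]
    refine ⟨(Finset.sdiff_subset).trans (Finset.union_subset hPr hQr), ?_, ?_⟩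
    · simp only [DD]
      rw [if_pos (by omega), if_pos (by omega), Finset.mem_powersetCard]
      refine ⟨?_, by omega⟩
      intro x hx
      rw [Finset.mem_sdiff]
      refine ⟨hPr (Finset.inter_subset_left hx), ?_⟩
      rw [hJ, Finset.mem_sdiff]
      tauto
    · have hRJ : R ⊆ J := by
        intro x hx
        simp only [hR, hJ, hD, Finset.mem_sdiff, Finset.mem_union, Finset.mem_inter] at hx ⊢
        tauto
      have ht : R.card = t J D ∨ R.card = t J D - 1 := by
        set base := ∑ x ∈ J, x + 2 * ∑ x ∈ D, x + h * D.card with hbase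
        have e : ∑ x ∈ B, x = base + h * R.card := by
          rw [hsum, ← c3]
          have : h * (R.card + D.card) = h * R.card + h * D.card := by ring
          omega
        have ht : t J D = (K - base) / h := rfl
        have l1 : R.card ≤ t J D := by
          rw [ht, Nat.le_div_iff_mul_le hh, mul_comm]; omega
        have l2 : t J D < R.card + 2 := by
          rw [ht, Nat.div_lt_iff_lt_mul hh]
          have : (R.card + 2) * h = h * R.card + 2 * h := by ring
          omega
        omega
      rw [Finset.mem_union, Finset.mem_powersetCard, Finset.mem_powersetCard]
      rcases ht with ht | ht
      · exact Or.inl ⟨hRJ, ht⟩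
      · exact Or.inr ⟨hRJ, ht⟩
  · simp only [f]
    have e1 : D ∪ J \ R = P := by
      ext x
      simp only [hR, hJ, hD, Finset.mem_sdiff, Finset.mem_union, Finset.mem_inter]
      tauto
    have e2 : D ∪ R = Q := by
      ext x
      simp only [hR, hD, Finset.mem_sdiff, Finset.mem_union, Finset.mem_inter]
      tauto
    rw [e1, e2, ← hBPQ]

/-- number of `a`-subsets of `{0, …, n-1}` with sum `K` -/
def xN (n a K : ℕ) : ℕ :=
  (((Finset.range n).powersetCard a).filter (fun A => ∑ x ∈ A, x = K)).card

lemma xN_mul_le (n c K : ℕ) : xN n (c + 1) K * (c + 1) ≤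
    (((Finset.range n).powersetCard c).filter
      (fun B => ∑ x ∈ B, x ≤ K ∧ K < ∑ x ∈ B, x + n)).card := by
  classical
  let S : Finset ((_ : Finset ℕ) × ℕ) :=
    (((Finset.range n).powersetCard (c + 1)).filter (fun A => ∑ x ∈ A, x = K)).sigma fun A => A
  have hS : S.card = xN n (c + 1) K * (c + 1) := by
    unfold xN
    rw [Finset.card_sigma, ← smul_eq_mul, ← Finset.sum_const]
    refine Finset.sum_congr rfl fun A hA => ?_
    simp only [Finset.mem_filter, Finset.mem_powersetCard] at hA
    exact hA.1.2
  have hmem : ∀ z ∈ S, z.1 ⊆ Finset.range n ∧ z.1.card = c + 1 ∧ ∑ x ∈ z.1, x = K ∧ z.2 ∈ z.1 := by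
    intro z hz
    simp only [S, Finset.mem_sigma, Finset.mem_filter, Finset.mem_powersetCard] at hz
    tauto
  rw [← hS]
  refine Finset.card_le_card_of_injOn (fun z => z.1.erase z.2) ?_ ?_
  · intro z hz
    obtain ⟨h1, h2, h3, h4⟩ := hmem z hz
    have := Finset.sum_erase_add z.1 (fun x => x) h4
    have hlt := Finset.mem_range.1 (h1 h4)
    simp only [Finset.coe_filter, Set.mem_ofPred_eq, Finset.mem_powersetCard]
    refine ⟨⟨(Finset.erase_subset _ _).trans h1, ?_⟩, ?_, ?_⟩
    · rw [Finset.card_erase_of_mem h4, h2]; rfl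
    · omega
    · omega
  · rintro ⟨A, x⟩ hz ⟨A', x'⟩ hz' heq
    obtain ⟨_, _, h3, h4⟩ := hmem _ hz
    obtain ⟨_, _, h3', h4'⟩ := hmem _ hz'
    simp only at h3 h4 h3' h4' heq
    have e := Finset.sum_erase_add A (fun x => x) h4
    have e' := Finset.sum_erase_add A' (fun x => x) h4'
    rw [← heq] at e'
    have hx : x = x' := by omega
    subst hx
    have : A = A' := by rw [← Finset.insert_erase h4, heq, Finset.insert_erase h4']
    subst this
    rfl

lemma xN_even (h a K : ℕ) (ha : 1 ≤ a) (hah : a ≤ h) :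
    h ^ 2 * a * (xN (2 * h) a K) ^ 2 ≤ 8 * ((2 * h).choose a) ^ 2 := by
  obtain ⟨c, rfl⟩ : ∃ c, a = c + 1 := ⟨a - 1, by omega⟩
  have h1 := (xN_mul_le (2 * h) c K).trans (window h c K (by omega))
  have h2 := sum_bound h c (by omega)
  have e : ∑ m ∈ Finset.range (h + 1), xq h c m * (2 * m.choose (m / 2))
      = 2 * ∑ m ∈ Finset.range (h + 1), xq h c m * m.choose (m / 2) := by
    rw [Finset.mul_sum]; exact Finset.sum_congr rfl fun m _ => by ring
  rw [e] at h1
  set W := ∑ m ∈ Finset.range (h + 1), xq h c m * m.choose (m / 2)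
  have h3 := Nat.choose_succ_right_eq (2 * h) c
  have h4 : (2 * h).choose c * h ≤ (2 * h).choose (c + 1) * (c + 1) := by
    rw [h3]; exact Nat.mul_le_mul_left _ (by omega)
  set N := xN (2 * h) (c + 1) K
  have h5 : (c + 1) ^ 2 * (h ^ 2 * (c + 1) * N ^ 2)
      ≤ (c + 1) ^ 2 * (8 * ((2 * h).choose (c + 1)) ^ 2) := by
    calc (c + 1) ^ 2 * (h ^ 2 * (c + 1) * N ^ 2) = h ^ 2 * (c + 1) * (N * (c + 1)) ^ 2 := by ring
      _ ≤ h ^ 2 * (c + 1) * (2 * W) ^ 2 := by gcongr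
      _ = 4 * h ^ 2 * ((c + 1) * W ^ 2) := by ring
      _ ≤ 4 * h ^ 2 * (2 * (2 * h).choose c ^ 2) := by gcongr
      _ = 8 * ((2 * h).choose c * h) ^ 2 := by ring
      _ ≤ 8 * ((2 * h).choose (c + 1) * (c + 1)) ^ 2 := by gcongr
      _ = _ := by ring
  exact Nat.le_of_mul_le_mul_left h5 (by positivity)

lemma xN_bound (n a K : ℕ) (ha : 1 ≤ a) (han : 2 * a ≤ n) :
    n ^ 2 * a * (xN n a K) ^ 2 ≤ 128 * (n.choose a) ^ 2 := by
  set h := (n + 1) / 2 with hh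
  have h1 := xN_even h a K ha (by omega)
  have h2 : xN n a K ≤ xN (2 * h) a K := by
    unfold xN
    refine Finset.card_le_card (Finset.filter_subset_filter _ (Finset.powersetCard_mono ?_))
    exact Finset.range_mono (by omega)
  have h3 : (2 * h).choose a ≤ 2 * n.choose a := by
    have : (2 * h).choose a ≤ (n + 1).choose a := Nat.choose_le_choose a (by omega)
    refine this.trans ?_
    have e := Nat.choose_mul_succ_eq n a
    have e2 : (n + 1).choose a * (n + 1) ≤ (n + 1).choose a * (2 * (n + 1 - a)) :=
      Nat.mul_le_mul_left _ (by omega)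
    have e3 : (n + 1).choose a * (n + 1) ≤ (2 * n.choose a) * (n + 1) := by nlinarith
    exact Nat.le_of_mul_le_mul_right e3 (by omega)
  have h4 : n ≤ 2 * h := by omega
  calc n ^ 2 * a * (xN n a K) ^ 2 ≤ (2 * h) ^ 2 * a * (xN (2 * h) a K) ^ 2 := by gcongr
    _ = 4 * (h ^ 2 * a * (xN (2 * h) a K) ^ 2) := by ring
    _ ≤ 4 * (8 * ((2 * h).choose a) ^ 2) := by gcongr
    _ ≤ 4 * (8 * (2 * n.choose a) ^ 2) := by gcongr
    _ = _ := by ring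

lemma xN_compl (n a b K : ℕ) (hn : a + b = n) :
    xN n a K ≤ xN n b (∑ x ∈ Finset.range n, x - K) := by
  classical
  unfold xN
  refine Finset.card_le_card_of_injOn (fun A => Finset.range n \ A) ?_ ?_
  · intro A hA
    simp only [Finset.coe_filter, Set.mem_ofPred_eq, Finset.mem_powersetCard] at hA ⊢
    obtain ⟨⟨h1, h2⟩, h3⟩ := hA
    have := Finset.sum_sdiff (f := fun x => x) h1
    refine ⟨⟨Finset.sdiff_subset, ?_⟩, by omega⟩
    rw [Finset.card_sdiff_of_subset h1, Finset.card_range]; omega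
  · intro A hA A' hA' heq
    simp only [Finset.coe_filter, Set.mem_ofPred_eq, Finset.mem_powersetCard] at hA hA'
    simp only at heq
    rw [← Finset.sdiff_sdiff_eq_self hA.1.1, heq, Finset.sdiff_sdiff_eq_self hA'.1.1]

lemma xN_bound' (a b K : ℕ) (ha : 1 ≤ a) (hb : 1 ≤ b) :
    a * b * (a + b) * (xN (a + b) a K) ^ 2 ≤ 128 * ((a + b).choose a) ^ 2 := by
  rcases le_total a b with h | h
  · have := xN_bound (a + b) a K ha (by omega)
    refine le_trans (Nat.mul_le_mul_right _ ?_) this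
    nlinarith [Nat.zero_le (a * (a + b))]
  · have h1 := xN_bound (a + b) b (∑ x ∈ Finset.range (a + b), x - K) hb (by omega)
    have h2 := xN_compl (a + b) a b K rfl
    have e : (a + b).choose a = (a + b).choose b := Nat.choose_symm_add
    rw [e]
    refine le_trans (Nat.mul_le_mul ?_ (Nat.pow_le_pow_left h2 2)) h1
    nlinarith [Nat.zero_le (b * (a + b))]

lemma perm_stab_card (a b : ℕ) :
    (Finset.univ.filter (fun w : Equiv.Perm (Fin (a + b)) =>
      ∀ i, ((w i : Fin (a + b)) : ℕ) < a ↔ (i : ℕ) < a)).card ≤ a.factorial * b.factorial := by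
  classical
  let p : Fin (a + b) → Prop := fun i => (i : ℕ) < a
  have hp : Fintype.card {i // p i} = a := by
    rw [Fintype.card_subtype]
    simp only [p]
    have := Fin.card_filter_val_lt (n := a + b) (m := a)
    omega
  have hp' : Fintype.card {i // ¬ p i} = b := by
    rw [Fintype.card_subtype_compl, hp, Fintype.card_fin]; omega
  let Φ : Equiv.Perm {i // p i} × Equiv.Perm {i // ¬ p i} → Equiv.Perm (Fin (a + b)) :=
    fun z => Equiv.Perm.subtypeCongr z.1 z.2
  have hc : (Finset.univ : Finset (Equiv.Perm {i // p i} × Equiv.Perm {i // ¬ p i})).card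
      = a.factorial * b.factorial := by
    rw [Finset.card_univ, Fintype.card_prod, Fintype.card_perm, Fintype.card_perm, hp, hp']
  rw [← hc]
  refine le_trans (Finset.card_le_card ?_) (Finset.card_image_le (f := Φ))
  intro w hw
  rw [Finset.mem_filter] at hw
  have hw := hw.2
  rw [Finset.mem_image]
  refine ⟨(w.subtypePerm (fun i => hw i), w.subtypePerm (fun i => not_congr (hw i))),
    Finset.mem_univ _, ?_⟩
  ext i
  simp only [Φ, Equiv.Perm.subtypeCongr.apply]
  split_ifs <;> simp

/-- The set of values of `w` on the first `a` positions. -/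
def xA (a b : ℕ) (w : Equiv.Perm (Fin (a + b))) : Finset ℕ :=
  (Finset.univ.filter (fun i : Fin (a + b) => (i : ℕ) < a)).image (fun i => (w i : ℕ))

lemma mem_xA (a b : ℕ) (w : Equiv.Perm (Fin (a + b))) (i : Fin (a + b)) :
    ((w i : Fin (a + b)) : ℕ) ∈ xA a b w ↔ (i : ℕ) < a := by
  unfold xA
  simp only [Finset.mem_image, Finset.mem_filter, Finset.mem_univ, true_and]
  constructor
  · rintro ⟨j, hj, hji⟩
    rw [Fin.val_inj] at hji
    rwa [← w.injective hji]
  · intro h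
    exact ⟨i, h, rfl⟩

lemma fiber_card (a b : ℕ) (A : Finset ℕ) :
    (Finset.univ.filter (fun w : Equiv.Perm (Fin (a + b)) => xA a b w = A)).card
      ≤ a.factorial * b.factorial := by
  classical
  by_cases hne : ∃ w₀, xA a b w₀ = A
  · obtain ⟨w₀, hw₀⟩ := hne
    refine le_trans ?_ (perm_stab_card a b)
    refine Finset.card_le_card_of_injOn (fun w => w₀⁻¹ * w) ?_ ?_
    · intro w hw
      simp only [Finset.coe_filter, Set.mem_ofPred_eq, Finset.mem_univ, true_and] at hw ⊢
      intro i
      rw [← mem_xA a b w₀, ← mem_xA a b w, hw, hw₀]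
      simp
    · intro w _ w' _ h
      exact mul_left_cancel h
  · push Not at hne
    rw [Finset.filter_false_of_mem (fun w _ => hne w)]
    simp

lemma card_xA (a b : ℕ) (w : Equiv.Perm (Fin (a + b))) : (xA a b w).card = a := by
  unfold xA
  rw [Finset.card_image_of_injective]
  · have := Fin.card_filter_val_lt (n := a + b) (m := a)
    omega
  · intro i j h
    simp only [Fin.val_inj] at h
    exact w.injective h

lemma sum_xA (a b : ℕ) (w : Equiv.Perm (Fin (a + b))) :
    ∑ x ∈ xA a b w, x = (Finset.univ.filter (fun p : Fin (a + b) × Fin (a + b) =>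
          (p.1 : ℕ) < a ∧ a ≤ (p.2 : ℕ) ∧ w p.2 < w p.1)).card + a.choose 2 := by
  classical
  set S := Finset.univ.filter (fun i : Fin (a + b) => (i : ℕ) < a) with hS
  have hSc : S.card = a := by
    rw [hS, Fin.card_filter_val_lt]
    omega
  have h1 : ∑ x ∈ xA a b w, x = ∑ i ∈ S, (w i : ℕ) := by
    unfold xA
    rw [Finset.sum_image]
    intro i _ j _ h
    simp only [Fin.val_inj] at h
    exact w.injective h
  have h2 : ∀ i, (w i : ℕ) = (Finset.univ.filter (fun j => w j < w i)).card := by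
    intro i
    have : (Finset.univ.filter (fun j => w j < w i)) = (Finset.Iio (w i)).map w.symm.toEmbedding := by
      ext j
      simp only [Finset.mem_filter, Finset.mem_univ, true_and, Finset.mem_map_equiv,
        Equiv.symm_symm, Finset.mem_Iio]
    rw [this, Finset.card_map, Fin.card_Iio]
  have h3 : ∑ i ∈ S, (w i : ℕ) = (Finset.univ.filter (fun p : Fin (a + b) × Fin (a + b) =>
      (p.1 : ℕ) < a ∧ w p.2 < w p.1)).card := by
    rw [Finset.sum_congr rfl fun i _ => h2 i, ← Finset.card_sigma]
    refine Finset.card_bij' (fun z _ => (z.1, z.2)) (fun p _ => ⟨p.1, p.2⟩) ?_ ?_ ?_ ?_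
    · intro z hz; simpa [hS] using hz
    · intro z hz; simpa [hS] using hz
    · intro z _; rfl
    · intro z _; rfl
  have h4 : (Finset.univ.filter (fun p : Fin (a + b) × Fin (a + b) =>
      (p.1 : ℕ) < a ∧ w p.2 < w p.1)).card = (Finset.univ.filter
        (fun p : Fin (a + b) × Fin (a + b) =>
          (p.1 : ℕ) < a ∧ a ≤ (p.2 : ℕ) ∧ w p.2 < w p.1)).card
      + (S.offDiag.filter (fun p => w p.2 < w p.1)).card := by
    rw [← Finset.card_union_of_disjoint]
    · congr 1
      ext p
      simp only [hS, Finset.mem_filter, Finset.mem_univ, true_and, Finset.mem_union,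
        Finset.mem_offDiag]
      constructor
      · rintro ⟨h, h'⟩
        by_cases hp : (p.2 : ℕ) < a
        · exact Or.inr ⟨⟨h, hp, fun e => by rw [e] at h'; exact lt_irrefl _ h'⟩, h'⟩
        · exact Or.inl ⟨h, by omega, h'⟩
      · rintro (⟨h, _, h'⟩ | ⟨⟨h, _⟩, h'⟩)
        · exact ⟨h, h'⟩
        · exact ⟨h, h'⟩
    · rw [Finset.disjoint_left]
      intro p hp hp'
      simp only [hS, Finset.mem_filter, Finset.mem_univ, true_and, Finset.mem_offDiag] at hp hp'
      omega
  have h5 : (S.offDiag.filter (fun p => w p.2 < w p.1)).card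
      = (S.offDiag.filter (fun p => ¬ w p.2 < w p.1)).card := by
    refine Finset.card_bij' (fun p _ => p.swap) (fun p _ => p.swap) ?_ ?_ ?_ ?_
    · intro p hp
      simp only [Finset.mem_filter, Finset.mem_offDiag, Prod.fst_swap, Prod.snd_swap] at hp ⊢
      exact ⟨⟨hp.1.2.1, hp.1.1, fun e => hp.1.2.2 e.symm⟩, not_lt.2 hp.2.le⟩
    · intro p hp
      simp only [Finset.mem_filter, Finset.mem_offDiag, Prod.fst_swap, Prod.snd_swap] at hp ⊢
      refine ⟨⟨hp.1.2.1, hp.1.1, fun e => hp.1.2.2 e.symm⟩, ?_⟩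
      exact lt_of_le_of_ne (not_lt.1 hp.2) fun e => hp.1.2.2 (w.injective e)
    · intro p _; simp
    · intro p _; simp
  have h6 := Finset.card_filter_add_card_filter_not (s := S.offDiag) (fun p => w p.2 < w p.1)
  rw [Finset.offDiag_card, hSc] at h6
  have h7 : (S.offDiag.filter (fun p => w p.2 < w p.1)).card = a.choose 2 := by
    rw [Nat.choose_two_right, Nat.mul_sub_one]
    omega
  rw [h1, h3, h4, h7]

lemma count_le (a b k : ℕ) :
    (Finset.univ.filter (fun w : Equiv.Perm (Fin (a + b)) =>
        (Finset.univ.filter (fun p : Fin (a + b) × Fin (a + b) =>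
          (p.1 : ℕ) < a ∧ a ≤ (p.2 : ℕ) ∧ w p.2 < w p.1)).card = k)).card
      ≤ a.factorial * b.factorial * xN (a + b) a (k + a.choose 2) := by
  classical
  unfold xN
  refine Finset.card_le_mul_card_image_of_maps_to (f := xA a b) ?_ _ ?_
  · intro w hw
    rw [Finset.mem_filter] at hw
    rw [Finset.mem_filter, Finset.mem_powersetCard, sum_xA, hw.2]
    refine ⟨⟨?_, card_xA a b w⟩, rfl⟩
    intro x hx
    unfold xA at hx
    rw [Finset.mem_image] at hx
    obtain ⟨i, _, rfl⟩ := hx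
    exact Finset.mem_range.2 (w i).2
  · intro A _
    refine le_trans (Finset.card_le_card ?_) (fiber_card a b A)
    exact Finset.filter_subset_filter _ (Finset.filter_subset _ _)

/-- **Maximum probability of the cross-inversion distribution.** There exists a constant
`C > 0` such that for all integers `a, b ≥ 1` and every integer `k` with `0 ≤ k ≤ ab`,
the number of permutations `w` of `{1, …, a+b}` with `xinv(w) = k` is at most
`C · (a+b)! / √(a·b·(a+b))`, where `xinv(w)` is the number of pairs `(i, j)` with
`1 ≤ i ≤ a < j ≤ a+b` and `w(i) > w(j)`. -/
theorem stmt2 : ∃ C : ℝ, 0 < C ∧ ∀ a b : ℕ, 1 ≤ a → 1 ≤ b → ∀ k : ℕ, k ≤ a * b →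
    ((Finset.univ.filter (fun w : Equiv.Perm (Fin (a + b)) =>
        (Finset.univ.filter (fun p : Fin (a + b) × Fin (a + b) =>
          (p.1 : ℕ) < a ∧ a ≤ (p.2 : ℕ) ∧ w p.2 < w p.1)).card = k)).card : ℝ)
      ≤ C * ((a + b).factorial : ℝ) / Real.sqrt ((a : ℝ) * b * (a + b)) := by
  refine ⟨12, by norm_num, ?_⟩
  intro a b ha hb k _
  have h1 := count_le a b k
  have h2 := xN_bound' a b (k + a.choose 2) ha hb
  have h3 := Nat.add_choose_mul_factorial_mul_factorial a b
  rw [← Nat.choose_symm_add] at h3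
  set M := (Finset.univ.filter (fun w : Equiv.Perm (Fin (a + b)) =>
        (Finset.univ.filter (fun p : Fin (a + b) × Fin (a + b) =>
          (p.1 : ℕ) < a ∧ a ≤ (p.2 : ℕ) ∧ w p.2 < w p.1)).card = k)).card
  set N := xN (a + b) a (k + a.choose 2)
  have h4 : a * b * (a + b) * M ^ 2 ≤ 144 * ((a + b).factorial) ^ 2 := by
    calc a * b * (a + b) * M ^ 2
        ≤ a * b * (a + b) * (a.factorial * b.factorial * N) ^ 2 := by gcongr
      _ = (a.factorial * b.factorial) ^ 2 * (a * b * (a + b) * N ^ 2) := by ring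
      _ ≤ (a.factorial * b.factorial) ^ 2 * (128 * ((a + b).choose a) ^ 2) := by gcongr
      _ = 128 * ((a + b).choose a * a.factorial * b.factorial) ^ 2 := by ring
      _ = 128 * ((a + b).factorial) ^ 2 := by rw [h3]
      _ ≤ _ := by gcongr; norm_num
  have h5 : (a : ℝ) * b * (a + b) * (M : ℝ) ^ 2 ≤ 144 * ((a + b).factorial : ℝ) ^ 2 := by
    exact_mod_cast h4
  have ha' : (0 : ℝ) < a := by exact_mod_cast ha
  have hb' : (0 : ℝ) < b := by exact_mod_cast hb
  have hpos : (0 : ℝ) < (a : ℝ) * b * (a + b) := by positivity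
  rw [le_div_iff₀ (Real.sqrt_pos.2 hpos)]
  refine abs_le_of_sq_le_sq' ?_ (by positivity) |>.2
  rw [mul_pow, Real.sq_sqrt hpos.le, mul_pow]
  linarith
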